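/- Let p : ℕ → (0,1) be any function and let G = G(n, p(n)). If an orientation D of G is chosen uniformly at random among the 2^{e(G)} possible orientations of G (equivalently, each edge of G is present independently with probability p and then each present edge is oriented in either direction with probability 1/2, independently over edges), then asymptotically almost surely D contains a Seymour vertex. -/

import Mathlib

/-- `D` is an orientation of the simple graph `G`: every arc of `D` lies on an edge of `G`,
and every edge of `G` is given exactly one of its two possible directions. -/
def IsOrientation {V : Type*} (G : SimpleGraph V) (D : V → V → Prop) : Prop :=
  (∀ u v, D u v → G.Adj u v) ∧ ∀ u v, G.Adj u v → (D u v ↔ ¬ D v u)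

/-- The first neighborhood (out-neighborhood) of `u` in the digraph `D`. -/
def firstNbhd {V : Type*} (D : V → V → Prop) (u : V) : Set V := {v | D u v}

/-- The second neighborhood of `u`: vertices whose shortest directed path from `u`
has exactly two arcs. -/
def secondNbhd {V : Type*} (D : V → V → Prop) (u : V) : Set V :=
  {v | ¬ D u v ∧ v ≠ u ∧ ∃ w, D u w ∧ D w v}

/-- A Seymour vertex: its second neighborhood is at least as large as its first. -/
def IsSeymourVertex {V : Type*} (D : V → V → Prop) (u : V) : Prop :=
  (firstNbhd D u).ncard ≤ (secondNbhd D u).ncard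

/-- The digraph `D` contains a Seymour vertex. -/
def HasSeymourVertex {V : Type*} (D : V → V → Prop) : Prop :=
  ∃ u, IsSeymourVertex D u

/- The probability that, when the binomial random graph `G(n,p)` is sampled and then an
orientation of it is chosen uniformly at random among its `2^{e(G)}` orientations, the
resulting oriented graph lies in `S`. -/
open scoped Classical in
noncomputable def gnpOrientProb (n : ℕ) (p : ℝ) (S : Set (Fin n → Fin n → Prop)) : ℝ :=
  ∑ G : SimpleGraph (Fin n),
    (p ^ G.edgeSet.ncard * (1 - p) ^ (n.choose 2 - G.edgeSet.ncard)) *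
      ((Nat.card {D : Fin n → Fin n → Prop // IsOrientation G D ∧ D ∈ S} : ℝ) /
        2 ^ G.edgeSet.ncard)

/-- Index set of unordered pairs. -/
abbrev PairIdx (n : ℕ) := {x : Fin n × Fin n // x.1 < x.2}

/-- Sample space: the state of every pair. -/
abbrev Om (n : ℕ) := PairIdx n → Option Bool

/-- Weight of a single pair state. -/
def wt (q : ℝ) : Option Bool → ℝ
  | none => 1 - 2 * q
  | some _ => q

/-- Weight of a configuration. -/
noncomputable def Wt {n : ℕ} (q : ℝ) (ω : Om n) : ℝ := ∏ e, wt q (ω e)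

/-- The digraph of a configuration. -/
def dig {n : ℕ} (ω : Om n) (u v : Fin n) : Prop :=
  (∃ h : u < v, ω ⟨(u, v), h⟩ = some true) ∨ (∃ h : v < u, ω ⟨(v, u), h⟩ = some false)

section
open scoped Classical

/-- Probability of an event. -/
noncomputable def Pr {n : ℕ} (q : ℝ) (E : Om n → Prop) : ℝ := ∑ ω, if E ω then Wt q ω else 0

lemma dig_fwd {n : ℕ} (ω : Om n) (e : PairIdx n) :
    dig ω e.1.1 e.1.2 ↔ ω e = some true := by
  unfold dig
  constructor
  · rintro (⟨h, h'⟩ | ⟨h, h'⟩)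
    · exact h'
    · exact absurd h (lt_asymm e.2)
  · intro h; exact Or.inl ⟨e.2, h⟩

lemma dig_bwd {n : ℕ} (ω : Om n) (e : PairIdx n) :
    dig ω e.1.2 e.1.1 ↔ ω e = some false := by
  unfold dig
  constructor
  · rintro (⟨h, h'⟩ | ⟨h, h'⟩)
    · exact absurd h (lt_asymm e.2)
    · exact h'
  · intro h; exact Or.inr ⟨e.2, h⟩

lemma dig_irrefl {n : ℕ} (ω : Om n) (u : Fin n) : ¬ dig ω u u := by
  rintro (⟨h, _⟩ | ⟨h, _⟩) <;> exact lt_irrefl _ h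

lemma dig_asymm {n : ℕ} (ω : Om n) (u v : Fin n) (h : dig ω u v) : ¬ dig ω v u := by
  intro h'
  rcases lt_trichotomy u v with hl | hl | hl
  · have a := (dig_fwd ω ⟨(u, v), hl⟩).1 h
    have b := (dig_bwd ω ⟨(u, v), hl⟩).1 h'
    rw [a] at b; simp at b
  · subst hl; exact dig_irrefl _ _ h
  · have a := (dig_fwd ω ⟨(v, u), hl⟩).1 h'
    have b := (dig_bwd ω ⟨(v, u), hl⟩).1 h
    rw [a] at b; simp at b

/-- Underlying graph. -/
def ugraph {n : ℕ} (ω : Om n) : SimpleGraph (Fin n) where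
  Adj u v := dig ω u v ∨ dig ω v u
  symm := ⟨fun _ _ h => h.symm⟩
  loopless := ⟨fun u h => by rcases h with h | h <;> exact dig_irrefl _ _ h⟩

lemma card_edge {n : ℕ} (G : SimpleGraph (Fin n)) :
    (Finset.univ.filter (fun e : PairIdx n => G.Adj e.1.1 e.1.2)).card = G.edgeSet.ncard := by
  rw [← Set.ncard_coe_finset]
  apply Set.ncard_congr (fun e _ => s(e.1.1, e.1.2))
  · intro e he; simpa using he
  · rintro ⟨⟨a, b⟩, h⟩ ⟨⟨c, d⟩, h'⟩ _ _ heq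
    simp only [Sym2.eq_iff] at heq
    rcases heq with ⟨rfl, rfl⟩ | ⟨rfl, rfl⟩
    · rfl
    · exact absurd h (lt_asymm h')
  · intro b
    induction b using Sym2.ind with
    | _ x y =>
      intro h
      rw [SimpleGraph.mem_edgeSet] at h
      rcases lt_trichotomy x y with hl | hl | hl
      · exact ⟨⟨(x, y), hl⟩, by simpa using h, rfl⟩
      · subst hl; exact absurd h (G.irrefl)
      · exact ⟨⟨(y, x), hl⟩, by simpa using h.symm, Sym2.eq_swap⟩

lemma card_pair (n : ℕ) : Fintype.card (PairIdx n) = n.choose 2 := by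
  have h := card_edge (⊤ : SimpleGraph (Fin n))
  have h2 := SimpleGraph.card_edgeFinset_top_eq_card_choose_two (V := Fin n)
  rw [Fintype.card_fin] at h2
  rw [← h2, ← Set.ncard_coe_finset, SimpleGraph.coe_edgeFinset, ← h]
  rw [← Finset.card_univ]
  congr 1
  ext e
  simp [ne_of_lt e.2]

lemma ugraph_adj {n : ℕ} (ω : Om n) (e : PairIdx n) :
    (ugraph ω).Adj e.1.1 e.1.2 ↔ ω e ≠ none := by
  show (dig ω _ _ ∨ dig ω _ _) ↔ _
  rw [dig_fwd, dig_bwd]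
  rcases ω e with _ | _ | _ <;> simp

lemma Wt_eq {n : ℕ} (q : ℝ) (ω : Om n) :
    Wt q ω = q ^ (ugraph ω).edgeSet.ncard *
      (1 - 2 * q) ^ (n.choose 2 - (ugraph ω).edgeSet.ncard) := by
  rw [← card_edge, ← card_pair]
  have h1 : ∀ e, wt q (ω e) = if (ugraph ω).Adj e.1.1 e.1.2 then q else 1 - 2 * q := by
    intro e
    rw [if_congr (ugraph_adj ω e) rfl rfl]
    rcases ω e with _ | _ <;> simp [wt]
  unfold Wt
  rw [Finset.prod_congr rfl (fun e _ => h1 e), Finset.prod_ite, Finset.prod_const,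
    Finset.prod_const]
  congr 2
  rw [← Finset.card_univ, ← Finset.card_filter_add_card_filter_not
    (s := (Finset.univ : Finset (PairIdx n))) (fun e => (ugraph ω).Adj e.1.1 e.1.2)]
  omega

lemma ugraph_orient {n : ℕ} (ω : Om n) : IsOrientation (ugraph ω) (dig ω) := by
  refine ⟨fun u v h => Or.inl h, fun u v h => ⟨fun a => dig_asymm ω u v a, fun a => ?_⟩⟩
  exact h.resolve_right a

lemma dig_inj {n : ℕ} : Function.Injective (dig : Om n → _) := by
  intro ω ω' h
  funext e
  have a := dig_fwd ω e
  have b := dig_bwd ω e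
  rw [h, dig_fwd] at a
  rw [h, dig_bwd] at b
  rcases h1 : ω e with _ | _ | _ <;> rcases h2 : ω' e with _ | _ | _ <;> simp_all

lemma card_bridge {n : ℕ} (G : SimpleGraph (Fin n)) (S : Set (Fin n → Fin n → Prop)) :
    (Finset.univ.filter (fun ω : Om n => ugraph ω = G ∧ dig ω ∈ S)).card =
      Nat.card {D : Fin n → Fin n → Prop // IsOrientation G D ∧ D ∈ S} := by
  rw [← Fintype.card_subtype, ← Nat.card_eq_fintype_card]
  refine Nat.card_congr (Equiv.ofBijective
    (fun ω => ⟨dig ω.1, by have h := ugraph_orient ω.1; simp only [ω.2.1] at h; exact h, ω.2.2⟩) ⟨?_, ?_⟩)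
  · intro a b h
    have := congrArg Subtype.val h
    exact Subtype.ext (dig_inj this)
  · rintro ⟨D, hD, hS⟩
    let ω : Om n := fun e => if D e.1.1 e.1.2 then some true else
      if D e.1.2 e.1.1 then some false else none
    have key : dig ω = D := by
      funext u v
      apply propext
      rcases lt_trichotomy u v with hl | hl | hl
      · rw [dig_fwd ω ⟨(u, v), hl⟩]
        simp only [ω]
        split_ifs <;> simp_all
      · subst hl
        exact ⟨fun h => absurd h (dig_irrefl _ _), fun h => absurd (hD.1 _ _ h) G.irrefl⟩
      · rw [dig_bwd ω ⟨(v, u), hl⟩]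
        simp only [ω]
        have := hD.2 v u
        have h2 := hD.1 v u
        split_ifs <;> simp_all
    refine ⟨⟨ω, ?_, by rw [key]; exact hS⟩, Subtype.ext key⟩
    ext u v
    show (dig ω u v ∨ dig ω v u) ↔ _
    rw [key]
    constructor
    · rintro (h | h)
      · exact hD.1 _ _ h
      · exact (hD.1 _ _ h).symm
    · intro h
      have := hD.2 u v h
      tauto

lemma bridge (n : ℕ) (p : ℝ) (S : Set (Fin n → Fin n → Prop)) :
    gnpOrientProb n p S = Pr (p / 2) (fun ω : Om n => dig ω ∈ S) := by
  unfold gnpOrientProb Pr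
  rw [← Finset.sum_fiberwise Finset.univ (fun ω : Om n => ugraph ω)]
  refine Finset.sum_congr rfl fun G _ => ?_
  rw [← card_bridge, Finset.sum_ite, Finset.sum_const_zero, add_zero, Finset.filter_filter]
  rw [Finset.sum_congr rfl (g := fun _ => (p / 2) ^ G.edgeSet.ncard *
      (1 - p) ^ (n.choose 2 - G.edgeSet.ncard))]
  · rw [Finset.sum_const, nsmul_eq_mul, div_pow]
    ring
  · intro ω hω
    rw [Finset.mem_filter] at hω
    rw [Wt_eq, hω.2.1, mul_div_cancel₀ _ (two_ne_zero)]

lemma wt_nonneg {q : ℝ} (h0 : 0 ≤ q) (h1 : q ≤ 1 / 2) (x : Option Bool) : 0 ≤ wt q x := by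
  rcases x with _ | _ <;> simp [wt] <;> linarith

lemma Wt_nonneg {n : ℕ} {q : ℝ} (h0 : 0 ≤ q) (h1 : q ≤ 1 / 2) (ω : Om n) : 0 ≤ Wt q ω :=
  Finset.prod_nonneg fun _ _ => wt_nonneg h0 h1 _

lemma Pr_eq_sum {n : ℕ} (q : ℝ) (E : Om n → Prop) :
    Pr q E = ∑ ω ∈ Finset.univ.filter E, Wt q ω := by
  unfold Pr
  rw [Finset.sum_filter]

lemma Pr_mono {n : ℕ} {q : ℝ} (h0 : 0 ≤ q) (h1 : q ≤ 1 / 2) {E F : Om n → Prop}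
    (h : ∀ ω, E ω → F ω) : Pr q E ≤ Pr q F := by
  refine Finset.sum_le_sum fun ω _ => ?_
  have := Wt_nonneg h0 h1 ω
  have := h ω
  split_ifs <;> first | linarith | tauto

/-- local constraint set -/
noncomputable def cset {n : ℕ} (F R : Finset (Fin n × Fin n)) (e : PairIdx n) :
    Finset (Option Bool) :=
  Finset.univ.filter fun x => (e.1 ∈ F → x ≠ some true) ∧ (e.1.swap ∈ F → x ≠ some false) ∧
    (e.1 ∈ R → x = some true) ∧ (e.1.swap ∈ R → x = some false)

lemma Pr_cset {n : ℕ} (q : ℝ) (F R : Finset (Fin n × Fin n))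
    (hd : ∀ x ∈ F ∪ R, x.1 ≠ x.2) :
    Pr q (fun ω : Om n => (∀ x ∈ F, ¬ dig ω x.1 x.2) ∧ ∀ x ∈ R, dig ω x.1 x.2) =
      ∏ e : PairIdx n, ∑ x ∈ cset F R e, wt q x := by
  rw [Finset.prod_univ_sum]
  rw [Pr_eq_sum]
  unfold Wt
  refine Finset.sum_congr ?_ fun _ _ => rfl
  ext ω
  simp only [Finset.mem_filter, Finset.mem_univ, true_and, Fintype.mem_piFinset, cset]
  constructor
  · rintro ⟨hF, hR⟩ e
    refine ⟨fun h => ?_, fun h => ?_, fun h => ?_, fun h => ?_⟩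
    · exact fun h' => hF _ h ((dig_fwd ω e).2 h')
    · exact fun h' => hF _ h ((dig_bwd ω e).2 h')
    · exact (dig_fwd ω e).1 (hR _ h)
    · exact (dig_bwd ω e).1 (hR _ h)
  · intro h
    constructor
    · rintro ⟨a, b⟩ hx
      rcases lt_trichotomy a b with hl | hl | hl
      · exact fun h' => (h ⟨(a, b), hl⟩).1 hx ((dig_fwd ω ⟨(a, b), hl⟩).1 h')
      · exact absurd hl (hd _ (Finset.mem_union_left _ hx))
      · exact fun h' => (h ⟨(b, a), hl⟩).2.1 hx ((dig_bwd ω ⟨(b, a), hl⟩).1 h')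
    · rintro ⟨a, b⟩ hx
      rcases lt_trichotomy a b with hl | hl | hl
      · exact (dig_fwd ω ⟨(a, b), hl⟩).2 ((h ⟨(a, b), hl⟩).2.2.1 hx)
      · exact absurd hl (hd _ (Finset.mem_union_right _ hx))
      · exact (dig_bwd ω ⟨(b, a), hl⟩).2 ((h ⟨(b, a), hl⟩).2.2.2 hx)

lemma prod_pairs {n : ℕ} (g : Fin n × Fin n → ℝ) (hg : ∀ a, g (a, a) = 1) :
    ∏ x, g x = ∏ e : PairIdx n, (g e.1 * g e.1.swap) := by
  have h1 : ∏ x, g x = (∏ x with x.1 < x.2, g x) * ∏ x with x.2 < x.1, g x := by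
    rw [← Finset.prod_filter_mul_prod_filter_not Finset.univ (fun x : Fin n × Fin n => x.1 < x.2)]
    congr 1
    symm
    apply Finset.prod_subset
    · intro x; simp only [Finset.mem_filter, Finset.mem_univ, true_and]; exact fun h => lt_asymm h
    · rintro ⟨a, b⟩ hx hx'
      simp only [Finset.mem_filter, Finset.mem_univ, true_and] at hx hx'
      have : a = b := le_antisymm (not_lt.1 hx') (not_lt.1 hx)
      subst this; exact hg a
  have h2 : ∏ x with x.2 < x.1, g x = ∏ x : Fin n × Fin n with x.1 < x.2, g x.swap := by
    apply Finset.prod_nbij' Prod.swap Prod.swap <;> simp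
  rw [h1, h2, ← Finset.prod_mul_distrib]
  exact (Finset.prod_subtype _ (by simp) _)

lemma prod_F {n : ℕ} (q : ℝ) (F R : Finset (Fin n × Fin n)) :
    ∏ x, ((if x ∈ F then 1 - q else 1) * (if x ∈ R then q else 1)) =
      (1 - q) ^ F.card * q ^ R.card := by
  rw [Finset.prod_mul_distrib]
  simp

lemma sum_cset {n : ℕ} (q : ℝ) (F R : Finset (Fin n × Fin n)) (e : PairIdx n) :
   ∑ x ∈ cset F R e, wt q x =
    (if e.1 ∈ R ∨ e.1.swap ∈ R then 0 else 1 - 2 * q) +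
    (if e.1 ∈ F ∨ e.1.swap ∈ R then 0 else q) +
    (if e.1.swap ∈ F ∨ e.1 ∈ R then 0 else q) := by
  unfold cset
  rw [Finset.sum_filter, Fintype.sum_option, Fintype.sum_bool]
  simp only [wt, add_assoc]
  by_cases h1 : e.1 ∈ R <;> by_cases h2 : e.1.swap ∈ R <;> by_cases h3 : e.1 ∈ F <;>
    by_cases h4 : e.1.swap ∈ F <;> simp [h1, h2, h3, h4]

lemma Pr_box {n : ℕ} (q : ℝ) (F R : Finset (Fin n × Fin n)) (hdis : ∀ x ∈ F, x ∉ R)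
    (hs : ∀ x ∈ F ∪ R, x.swap ∉ F ∪ R) :
    Pr q (fun ω : Om n => (∀ x ∈ F, ¬ dig ω x.1 x.2) ∧ ∀ x ∈ R, dig ω x.1 x.2) =
      (1 - q) ^ F.card * q ^ R.card := by
  have hd : ∀ x ∈ F ∪ R, x.1 ≠ x.2 := by
    rintro ⟨a, b⟩ hx h
    simp only at h
    subst h
    exact hs _ hx hx
  rw [Pr_cset q F R hd, ← prod_F, prod_pairs]
  · refine Finset.prod_congr rfl fun e _ => ?_
    rw [sum_cset]
    have a1 := hs e.1
    have a2 := hs e.1.swap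
    have a3 := hdis e.1
    have a4 := hdis e.1.swap
    simp only [Finset.mem_union, Prod.swap_swap] at a1 a2
    by_cases h1 : e.1 ∈ R <;> by_cases h2 : e.1.swap ∈ R <;> by_cases h3 : e.1 ∈ F <;>
      by_cases h4 : e.1.swap ∈ F <;> simp [h1, h2, h3, h4] at a1 a2 a3 a4 ⊢ <;> ring
  · intro a
    have h1 : (a, a) ∉ F := fun h => hd _ (Finset.mem_union_left _ h) rfl
    have h2 : (a, a) ∉ R := fun h => hd _ (Finset.mem_union_right _ h) rfl
    simp [h1, h2]

lemma Pr_box_le {n : ℕ} {q : ℝ} (h0 : 0 ≤ q) (hq : q ≤ 1 / 2) (F : Finset (Fin n × Fin n))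
    (hd : ∀ x ∈ F, x.1 ≠ x.2) :
    Pr q (fun ω : Om n => ∀ x ∈ F, ¬ dig ω x.1 x.2) ≤ (1 - q) ^ F.card := by
  have h := Pr_cset q F ∅ (by simpa using hd)
  have h' := prod_F q F ∅
  simp only [Finset.notMem_empty, false_imp_iff, implies_true, and_true, Finset.card_empty,
    pow_zero, mul_one, if_false] at h h'
  rw [h, ← h', prod_pairs]
  · refine Finset.prod_le_prod
      (fun e _ => Finset.sum_nonneg fun x _ => wt_nonneg h0 hq x) fun e _ => ?_
    rw [sum_cset]
    by_cases h3 : e.1 ∈ F <;> by_cases h4 : e.1.swap ∈ F <;> simp [h3, h4] <;> nlinarith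
  · intro a
    have h1 : (a, a) ∉ F := fun h => hd _ h rfl
    simp [h1]

lemma Pr_univ {n : ℕ} (q : ℝ) : ∑ ω : Om n, Wt q ω = 1 := by
  have := Pr_box (n := n) q ∅ ∅ (by simp) (by simp)
  simpa [Pr] using this

lemma cheb {Ω V : Type*} [Fintype Ω] (w : Ω → ℝ) (hw : ∀ ω, 0 ≤ w ω) (T : Finset V)
    (E : V → Ω → Prop) (m s t : ℝ) (ht : 0 < t) (h0 : ∑ ω, w ω = m)
    (h1 : ∀ v ∈ T, (∑ ω, if E v ω then w ω else 0) = m * s)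
    (h2 : ∀ v ∈ T, ∀ v' ∈ T, v ≠ v' →
      (∑ ω, if E v ω ∧ E v' ω then w ω else 0) ≤ m * s ^ 2) :
    (∑ ω, if t ≤ |((T.filter (fun v => E v ω)).card : ℝ) - T.card * s| then w ω else 0) ≤
      m * (T.card * (s * (1 - s))) / t ^ 2 := by
  set X : Ω → ℝ := fun ω => ((T.filter (fun v => E v ω)).card : ℝ) with hX
  have hXs : ∀ ω, X ω = ∑ v ∈ T, if E v ω then 1 else 0 := by
    intro ω; simp [hX]
  have e1 : ∑ ω, w ω * X ω = T.card * (m * s) := by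
    simp_rw [hXs, Finset.mul_sum]
    rw [Finset.sum_comm, Finset.sum_congr rfl (g := fun _ => m * s)]
    · simp
    · intro v hv
      rw [← h1 v hv]
      simp
  have e2 : ∑ ω, w ω * X ω ^ 2 ≤ T.card * (m * s) + T.card * (T.card - 1) * (m * s ^ 2) := by
    have : ∑ ω, w ω * X ω ^ 2 =
        ∑ v ∈ T, ∑ v' ∈ T, ∑ ω, if E v ω ∧ E v' ω then w ω else 0 := by
      simp_rw [hXs, sq, Finset.sum_mul_sum, Finset.mul_sum]
      rw [Finset.sum_comm]
      refine Finset.sum_congr rfl fun v _ => ?_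
      rw [Finset.sum_comm]
      refine Finset.sum_congr rfl fun v' _ => Finset.sum_congr rfl fun ω _ => ?_
      by_cases a : E v ω <;> by_cases b : E v' ω <;> simp [a, b]
    rw [this]
    have : ∀ v ∈ T, (∑ v' ∈ T, ∑ ω, if E v ω ∧ E v' ω then w ω else 0) ≤
        m * s + (T.card - 1) * (m * s ^ 2) := by
      intro v hv
      rw [← Finset.add_sum_erase _ _ hv]
      apply add_le_add
      · simp [h1 v hv]
      · refine (Finset.sum_le_card_nsmul _ _ (m * s ^ 2) ?_).trans ?_
        · intro v' hv'
          rw [Finset.mem_erase] at hv'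
          exact h2 v hv v' hv'.2 hv'.1.symm
        · rw [Finset.card_erase_of_mem hv, nsmul_eq_mul, Nat.cast_sub]
          · simp
          · exact Finset.card_pos.2 ⟨v, hv⟩
    refine (Finset.sum_le_card_nsmul _ _ _ this).trans ?_
    rw [nsmul_eq_mul]
    apply le_of_eq; ring
  rw [le_div_iff₀ (by positivity), Finset.sum_mul]
  calc _ ≤ ∑ ω, w ω * (X ω - T.card * s) ^ 2 := by
        refine Finset.sum_le_sum fun ω _ => ?_
        split_ifs with h
        · apply mul_le_mul_of_nonneg_left _ (hw ω)
          rw [← sq_abs (X ω - _)]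
          gcongr
        · rw [zero_mul]; exact mul_nonneg (hw ω) (sq_nonneg _)
    _ = ∑ ω, w ω * X ω ^ 2 - 2 * (T.card * s) * ∑ ω, w ω * X ω + (T.card * s) ^ 2 * ∑ ω, w ω := by
        rw [Finset.mul_sum, Finset.mul_sum, ← Finset.sum_sub_distrib, ← Finset.sum_add_distrib]
        refine Finset.sum_congr rfl fun ω _ => ?_
        ring
    _ ≤ _ := by
        rw [e1, h0]
        nlinarith [e2]

/-- Out-neighbourhood as a finset. -/
noncomputable def outN {n : ℕ} (ω : Om n) (u : Fin n) : Finset (Fin n) :=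
  Finset.univ.filter fun v => dig ω u v

lemma mem_outN {n : ℕ} (ω : Om n) (u v : Fin n) : v ∈ outN ω u ↔ dig ω u v := by
  simp [outN]

lemma notMem_outN {n : ℕ} (ω : Om n) (u : Fin n) : u ∉ outN ω u := by
  rw [mem_outN]; exact dig_irrefl ω u

lemma seymour_of {n : ℕ} (ω : Om n) (u : Fin n)
    (h : (outN ω u).card +
      (((insert u (outN ω u))ᶜ).filter (fun v => ∀ w ∈ outN ω u, ¬ dig ω w v)).card ≤
      ((insert u (outN ω u))ᶜ).card) : IsSeymourVertex (dig ω) u := by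
  unfold IsSeymourVertex
  have h1 : firstNbhd (dig ω) u = (outN ω u : Set (Fin n)) := by
    ext v; simp [firstNbhd, outN]
  have h2 : secondNbhd (dig ω) u = ((((insert u (outN ω u))ᶜ).filter
      (fun v => ¬ ∀ w ∈ outN ω u, ¬ dig ω w v) : Finset (Fin n)) : Set (Fin n)) := by
    ext v
    simp only [secondNbhd, Set.mem_ofPred_eq, Finset.coe_filter, Finset.mem_compl,
      Finset.mem_insert, mem_outN]
    push Not
    tauto
  rw [h1, h2, Set.ncard_coe_finset, Set.ncard_coe_finset]
  have := Finset.card_filter_add_card_filter_not (s := (insert u (outN ω u))ᶜ)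
    (fun v => ∀ w ∈ outN ω u, ¬ dig ω w v)
  omega

lemma Pr_A {n : ℕ} (q : ℝ) (u : Fin n) (A K : Finset (Fin n)) (hu : u ∉ A)
    (hK : ∀ v ∈ K, v ∉ insert u A) :
    Pr q (fun ω : Om n => outN ω u = A ∧ ∀ v ∈ K, ∀ w ∈ A, ¬ dig ω w v) =
      (1 - q) ^ ((n - 1 - A.card) + A.card * K.card) * q ^ A.card := by
  have h := Pr_box q (({u} ×ˢ (insert u A)ᶜ) ∪ (A ×ˢ K)) (({u} : Finset (Fin n)) ×ˢ A) ?_ ?_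
  · rw [Finset.card_union_of_disjoint, Finset.card_product, Finset.card_product,
      Finset.card_product, Finset.card_compl, Finset.card_insert_of_notMem hu, Fintype.card_fin,
      Finset.card_singleton, one_mul, one_mul, add_comm A.card 1, ← Nat.sub_sub] at h
    · rw [← h]
      congr 1
      funext ω
      apply propext
      constructor
      · rintro ⟨h1, h2⟩
        subst h1
        constructor
        · rintro ⟨a, b⟩ hx
          simp only [Finset.mem_union, Finset.mem_product, Finset.mem_singleton, Finset.mem_compl,
            Finset.mem_insert] at hx
          rcases hx with ⟨rfl, hx⟩ | hx
          · intro h'; exact hx (Or.inr ((mem_outN _ _ _).2 h'))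
          · exact h2 _ hx.2 _ hx.1
        · rintro ⟨a, b⟩ hx
          simp only [Finset.mem_product, Finset.mem_singleton] at hx
          rw [hx.1]
          exact (mem_outN _ _ _).1 hx.2
      · rintro ⟨h1, h2⟩
        constructor
        · ext v
          rw [mem_outN]
          constructor
          · intro hv
            by_contra hvA
            refine h1 (u, v) ?_ hv
            simp only [Finset.mem_union, Finset.mem_product, Finset.mem_singleton,
              Finset.mem_compl, Finset.mem_insert]
            refine Or.inl ⟨trivial, ?_⟩
            rintro (rfl | h)
            · exact dig_irrefl _ _ hv
            · exact hvA h
          · intro hv; exact h2 (u, v) (by simp [hv])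
        · intro v hv w hw
          exact h1 (w, v) (by simp [hv, hw])
    · rw [Finset.disjoint_left]
      rintro ⟨a, b⟩ hx hx'
      simp only [Finset.mem_product, Finset.mem_singleton] at hx hx'
      rw [hx.1] at hx'
      exact hu hx'.1
  · rintro ⟨a, b⟩ hx hx'
    simp only [Finset.mem_union, Finset.mem_product, Finset.mem_singleton, Finset.mem_compl,
            Finset.mem_insert] at hx hx'
    rcases hx with hx | hx
    · exact hx.2 (Or.inr hx'.2)
    · rw [hx'.1] at hx; exact hu hx.1
  · rintro ⟨a, b⟩ hx hx'
    simp only [Finset.mem_union, Finset.mem_product, Finset.mem_singleton, Finset.mem_compl,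
            Finset.mem_insert, Prod.swap] at hx hx'
    have a1 := hK a
    have a2 := hK b
    simp only [Finset.mem_insert] at a1 a2
    by_cases c1 : a = u <;> by_cases c2 : b = u <;> simp_all

lemma Pr_exists_le {n : ℕ} {q : ℝ} (h0 : 0 ≤ q) (h1 : q ≤ 1 / 2) {ι : Type*} (s : Finset ι)
    (E : ι → Om n → Prop) : Pr q (fun ω => ∃ i ∈ s, E i ω) ≤ ∑ i ∈ s, Pr q (E i) := by
  unfold Pr
  rw [Finset.sum_comm]
  refine Finset.sum_le_sum fun ω _ => ?_
  have hn : ∀ i ∈ s, 0 ≤ (if E i ω then Wt q ω else 0) := by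
    intro i _; split_ifs
    · exact Wt_nonneg h0 h1 ω
    · exact le_rfl
  split_ifs with h
  · obtain ⟨i, hi, hE⟩ := h
    have := Finset.single_le_sum hn hi
    rwa [if_pos hE] at this
  · exact Finset.sum_nonneg hn

lemma Pr_or_le {n : ℕ} {q : ℝ} (h0 : 0 ≤ q) (h1 : q ≤ 1 / 2)
    (E F : Om n → Prop) : Pr q (fun ω => E ω ∨ F ω) ≤ Pr q E + Pr q F := by
  unfold Pr
  rw [← Finset.sum_add_distrib]
  refine Finset.sum_le_sum fun ω _ => ?_
  have := Wt_nonneg h0 h1 ω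
  by_cases a : E ω <;> by_cases b : F ω <;> simp [a, b, this]

lemma exists_small {n : ℕ} (hn : 0 < n) (ω : Om n) : ∃ u, 2 * (outN ω u).card ≤ n - 1 := by
  by_contra! hc
  have h1 : ∑ u, (outN ω u).card =
      ∑ u, (Finset.univ.filter fun v => dig ω v u).card := by
    exact Finset.sum_card_bipartiteAbove_eq_sum_card_bipartiteBelow (dig ω)
  have h2 : ∀ u, (outN ω u).card + (Finset.univ.filter fun v => dig ω v u).card ≤ n - 1 := by
    intro u
    rw [← Finset.card_union_of_disjoint]
    · have : (outN ω u ∪ Finset.univ.filter fun v => dig ω v u) ⊆ Finset.univ.erase u := by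
        intro v hv
        simp only [Finset.mem_union, mem_outN, Finset.mem_filter, Finset.mem_univ, true_and] at hv
        simp only [Finset.mem_erase, Finset.mem_univ, and_true]
        rintro rfl
        rcases hv with hv | hv <;> exact dig_irrefl _ _ hv
      have h := Finset.card_le_card this
      simpa using h
    · rw [Finset.disjoint_left]
      intro v hv hv'
      rw [mem_outN] at hv
      simp only [Finset.mem_filter, Finset.mem_univ, true_and] at hv'
      exact dig_asymm _ _ _ hv hv'
  have h3 := Finset.sum_le_sum fun u (_ : u ∈ Finset.univ) => h2 u
  rw [Finset.sum_add_distrib, ← h1] at h3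
  have h4 : ∑ u : Fin n, (n - 1) < ∑ u, 2 * (outN ω u).card :=
    Finset.sum_lt_sum_of_nonempty ⟨⟨0, hn⟩, Finset.mem_univ _⟩ fun u _ => hc u
  rw [← Finset.mul_sum] at h4
  omega

lemma dense {n : ℕ} (hn : 2 ≤ n) {q : ℝ} (hq0 : 1 / 10 ≤ q) (hq : q ≤ 1 / 2) :
    Pr q (fun ω : Om n => ¬ HasSeymourVertex (dig ω)) ≤ n ^ 2 * (99 / 100 : ℝ) ^ (n - 2) := by
  have h0 : 0 ≤ q := by linarith
  have step : ∀ x ∈ (Finset.univ : Finset (Fin n)).offDiag, Pr q (fun ω : Om n =>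
      x.2 ∉ outN ω x.1 ∧ ∀ w ∈ outN ω x.1, ¬ dig ω w x.2) ≤ (99 / 100 : ℝ) ^ (n - 2) := by
    rintro ⟨u, v⟩ hx
    have huv : u ≠ v := by simpa using hx
    have e : Pr q (fun ω : Om n => v ∉ outN ω u ∧ ∀ w ∈ outN ω u, ¬ dig ω w v) ≤
      Pr q (fun ω : Om n => ∃ A ∈ (({u, v} : Finset (Fin n))ᶜ).powerset,
        (outN ω u = A ∧ ∀ v' ∈ ({v} : Finset (Fin n)), ∀ w ∈ A, ¬ dig ω w v')) := by
      refine Pr_mono h0 hq fun ω hω => ⟨outN ω u, ?_, rfl, ?_⟩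
      · rw [Finset.mem_powerset]
        intro z hz
        simp only [Finset.mem_compl, Finset.mem_insert, Finset.mem_singleton]
        rintro (rfl | rfl)
        · exact notMem_outN _ _ hz
        · exact hω.1 hz
      · simpa using hω.2
    refine e.trans ((Pr_exists_le h0 hq _ _).trans ?_)
    have hc : (({u, v} : Finset (Fin n))ᶜ).card = n - 2 := by
      rw [Finset.card_compl, Finset.card_pair huv, Fintype.card_fin]
    have : ∀ A ∈ (({u, v} : Finset (Fin n))ᶜ).powerset, Pr q (fun ω : Om n => outN ω u = A ∧
        ∀ v' ∈ ({v} : Finset (Fin n)), ∀ w ∈ A, ¬ dig ω w v') =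
        (1 - q) ^ (n - 1) * (q ^ A.card * 1 ^ ((({u, v} : Finset (Fin n))ᶜ).card - A.card)) := by
      intro A hA
      rw [Finset.mem_powerset] at hA
      have hu : u ∉ A := fun h => by simpa using hA h
      have hv : v ∉ A := fun h => by simpa using hA h
      have hcard := Finset.card_le_card hA
      rw [Pr_A q u A {v} hu (by simp [hv, huv.symm]), Finset.card_singleton, mul_one, one_pow,
        mul_one]
      congr 2
      omega
    rw [Finset.sum_congr rfl this, ← Finset.mul_sum, Finset.sum_pow_mul_eq_add_pow, hc]
    have hn1 : n - 1 = (n - 2) + 1 := by omega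
    rw [hn1, pow_succ]
    calc (1 - q) ^ (n - 2) * (1 - q) * (q + 1) ^ (n - 2)
        = ((1 - q) * (q + 1)) ^ (n - 2) * (1 - q) := by rw [mul_pow]; ring
      _ ≤ ((1 - q) * (q + 1)) ^ (n - 2) * 1 := by
          apply mul_le_mul_of_nonneg_left (by linarith)
          apply pow_nonneg; nlinarith
      _ ≤ _ := by
          rw [mul_one]
          apply pow_le_pow_left₀ <;> nlinarith
  have main : Pr q (fun ω : Om n => ¬ HasSeymourVertex (dig ω)) ≤ Pr q (fun ω : Om n =>
      ∃ x ∈ (Finset.univ : Finset (Fin n)).offDiag, 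
      x.2 ∉ outN ω x.1 ∧ ∀ w ∈ outN ω x.1, ¬ dig ω w x.2) := by
    refine Pr_mono h0 hq fun ω hω => ?_
    by_contra hc
    push Not at hc
    obtain ⟨u, hu⟩ := exists_small (by omega) ω
    apply hω
    refine ⟨u, seymour_of ω u ?_⟩
    rw [Finset.filter_false_of_mem, Finset.card_empty, Finset.card_compl,
      Finset.card_insert_of_notMem (notMem_outN _ _), Fintype.card_fin]
    · omega
    · intro v hv
      simp only [Finset.mem_compl, Finset.mem_insert, not_or] at hv
      obtain ⟨w, hw, hw'⟩ := hc (u, v) (by simpa using Ne.symm hv.1) hv.2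
      exact fun h => h w hw hw'
  refine main.trans ((Pr_exists_le h0 hq _ _).trans ((Finset.sum_le_card_nsmul _ _ _ step).trans ?_))
  rw [nsmul_eq_mul]
  apply mul_le_mul_of_nonneg_right _ (by positivity)
  rw [Finset.offDiag_card, Finset.card_univ, Fintype.card_fin]
  have : n * n - n ≤ n ^ 2 := by rw [sq]; omega
  exact_mod_cast this

/-- `u` has no out-neighbours. -/
def IsSink {n : ℕ} (u : Fin n) (ω : Om n) : Prop :=
  ∀ x ∈ ({u} : Finset (Fin n)) ×ˢ Finset.univ.erase u, ¬ dig ω x.1 x.2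

lemma sparse {n : ℕ} (hn : 0 < n) {q : ℝ} (hq0 : 0 ≤ q) (hq : q ≤ 1 / 2) :
    Pr q (fun ω : Om n => ¬ HasSeymourVertex (dig ω)) ≤ 1 / (n * (1 - q) ^ (n - 1)) := by
  set r := (1 - q) ^ (n - 1) with hr
  have hr0 : 0 < r := by apply pow_pos; linarith
  have hn' : (0 : ℝ) < n := by exact_mod_cast hn
  have hT : ((Finset.univ : Finset (Fin n)).card : ℝ) = n := by simp
  have key := cheb (Wt q) (Wt_nonneg hq0 hq) (Finset.univ : Finset (Fin n))
    IsSink 1 r (n * r)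
    (by positivity) (Pr_univ q) ?_ ?_
  · rw [hT] at key
    refine le_trans ?_ (key.trans ?_)
    · refine Pr_mono hq0 hq fun ω hω => ?_
      rw [Finset.filter_false_of_mem]
      · simp only [Finset.card_empty, Nat.cast_zero, zero_sub, abs_neg]
        exact le_abs_self _
      · intro u _ hu
        apply hω
        refine ⟨u, seymour_of ω u ?_⟩
        have : outN ω u = ∅ := by
          rw [Finset.eq_empty_iff_forall_notMem]
          intro v hv
          rw [mem_outN] at hv
          refine hu (u, v) ?_ hv
          simp only [Finset.mem_product, Finset.mem_singleton, Finset.mem_erase, Finset.mem_univ,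
            and_true, true_and]
          rintro rfl
          exact dig_irrefl _ _ hv
        rw [this, Finset.card_empty, zero_add]
        exact Finset.card_le_card (Finset.filter_subset _ _)
    · rw [div_le_div_iff₀ (by positivity) (by positivity)]
      have : 0 ≤ (n * r) * (n * r) * r := by positivity
      nlinarith
  · intro u _
    have h := Pr_box (n := n) q (({u} : Finset (Fin n)) ×ˢ Finset.univ.erase u) ∅ (by simp) ?_
    · simp only [Finset.notMem_empty, false_imp_iff, implies_true, and_true] at h
      rw [one_mul]
      refine Eq.trans (b := Pr q (IsSink u)) rfl ?_
      unfold IsSink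
      rw [h, Finset.card_product]
      simp [hr]
    · rintro ⟨a, b⟩
      simp only [Finset.union_empty, Finset.mem_product, Finset.mem_singleton, Finset.mem_erase,
        Finset.mem_univ, and_true, Prod.swap]
      tauto
  · intro u _ u' _ huu
    have h := Pr_box_le (n := n) hq0 hq ((({u} : Finset (Fin n)) ×ˢ Finset.univ.erase u) ∪
      (({u'} : Finset (Fin n)) ×ˢ Finset.univ.erase u')) ?_
    · rw [Finset.card_union_of_disjoint, Finset.card_product, Finset.card_product] at h
      · simp only [Finset.card_singleton, one_mul, Finset.card_erase_of_mem (Finset.mem_univ _),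
          Finset.card_univ, Fintype.card_fin] at h
        rw [one_mul, sq, hr, ← pow_add]
        refine le_trans (le_of_eq ?_) h
        unfold Pr
        refine Finset.sum_congr rfl fun ω _ => ?_
        have e : (IsSink u ω ∧ IsSink u' ω) ↔ _ := Finset.forall_mem_union.symm
        by_cases a : IsSink u ω ∧ IsSink u' ω
        · rw [if_pos a, if_pos (e.1 a)]
        · rw [if_neg a, if_neg (fun h => a (e.2 h))]
      · rw [Finset.disjoint_left]
        rintro ⟨a, b⟩
        simp only [Finset.mem_product, Finset.mem_singleton]
        rintro ⟨rfl, _⟩ ⟨h, _⟩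
        exact huu h
    · rintro ⟨a, b⟩
      simp only [Finset.mem_union, Finset.mem_product, Finset.mem_singleton, Finset.mem_erase,
        Finset.mem_univ, and_true]
      rintro (⟨rfl, h⟩ | ⟨rfl, h⟩) <;> exact h.symm

/-- `v` receives no arc from `A`. -/
def NoHit {n : ℕ} (A : Finset (Fin n)) (v : Fin n) (ω : Om n) : Prop := ∀ w ∈ A, ¬ dig ω w v

lemma mid_arith {a τ q s L N : ℝ} (hq0 : 0 < q) (hq : q ≤ 1 / 10) (hL : L = N * q) (hL8 : 8 ≤ L)
    (h1 : L / 2 ≤ a) (h2 : a ≤ 3 * L / 2) (hτ : τ = N - a)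
    (hs : s ≤ 1 - 34 / 10 * q) :
    0 < τ * (1 - s) - a ∧ τ * (s * (1 - s)) / (τ * (1 - s) - a) ^ 2 ≤ 12 / L := by
  have hN : 0 < N := by
    by_contra h
    nlinarith
  have hτ1 : 85 / 100 * N ≤ τ := by nlinarith
  have hτr : 289 / 100 * L ≤ τ * (1 - s) := by
    calc 289 / 100 * L = (85 / 100 * N) * (34 / 10 * q) := by rw [hL]; ring
      _ ≤ τ * (1 - s) := by
        apply mul_le_mul hτ1 (by linarith) (by positivity) (by linarith)
  set x := τ * (1 - s) with hx
  have ht : x / 3 ≤ x - a := by linarith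
  have hx0 : 0 < x := by linarith
  refine ⟨by linarith, ?_⟩
  rw [div_le_div_iff₀ (by apply pow_pos; linarith) (by linarith)]
  have e : τ * (s * (1 - s)) = x * s := by rw [hx]; ring
  rw [e]
  have h3 : (x / 3) ^ 2 ≤ (x - a) ^ 2 := by gcongr
  have h4 : x * s * L ≤ x * 1 * L := by gcongr; linarith
  nlinarith

lemma pow_bound {q : ℝ} (hq0 : 0 < q) (hq : q ≤ 1 / 10) {k : ℕ} (hk : 4 ≤ k) :
    (1 - q) ^ k ≤ 1 - 34 / 10 * q := by
  have h : (1 - q) ^ k ≤ (1 - q) ^ 4 := pow_le_pow_of_le_one (by linarith) (by linarith) hk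
  have h2 : (1 - q) ^ 4 = 1 - 4 * q + 6 * q ^ 2 - q ^ 3 * (4 - q) := by ring
  have h3 : 0 ≤ q ^ 3 * (4 - q) := mul_nonneg (by positivity) (by linarith)
  nlinarith

lemma mid_step {n : ℕ} {q : ℝ} (hq0 : 0 < q) (hq : q ≤ 1 / 10)
    (hL8 : 8 ≤ ((n - 1 : ℕ) : ℝ) * q) (u : Fin n) (A : Finset (Fin n)) (hu : u ∉ A)
    (h1 : ((n - 1 : ℕ) : ℝ) * q / 2 ≤ A.card) (h2 : (A.card : ℝ) ≤ 3 * (((n - 1 : ℕ) : ℝ) * q) / 2) :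
    Pr q (fun ω : Om n => outN ω u = A ∧ ((insert u A)ᶜ).card <
      A.card + (((insert u A)ᶜ).filter (fun v => NoHit A v ω)).card) ≤
      Pr q (fun ω : Om n => outN ω u = A) * (12 / (((n - 1 : ℕ) : ℝ) * q)) := by
  have hq2 : q ≤ 1 / 2 := by linarith
  have hcard : A.card + 1 ≤ n := by
    have := Finset.card_le_univ (insert u A)
    rwa [Finset.card_insert_of_notMem hu, Fintype.card_fin] at this
  have hTn : ((insert u A)ᶜ).card = n - 1 - A.card := by
    rw [Finset.card_compl, Finset.card_insert_of_notMem hu, Fintype.card_fin]; omega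
  have hT : (((insert u A)ᶜ).card : ℝ) = ((n - 1 : ℕ) : ℝ) - A.card := by
    rw [hTn, Nat.cast_sub (by omega)]
  have hk : 4 ≤ A.card := by
    have : (4 : ℝ) ≤ A.card := by linarith
    exact_mod_cast this
  obtain ⟨ht, har⟩ := mid_arith hq0 hq rfl hL8 h1 h2 hT
    (s := (1 - q) ^ A.card) (pow_bound hq0 hq hk)
  have hm : Pr q (fun ω : Om n => outN ω u = A) = (1 - q) ^ (n - 1 - A.card) * q ^ A.card := by
    have := Pr_A q u A ∅ hu (by simp)
    simpa using this
  have hw : ∀ ω : Om n, 0 ≤ (if outN ω u = A then Wt q ω else 0) := by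
    intro ω; split_ifs
    · exact Wt_nonneg hq0.le hq2 ω
    · exact le_rfl
  have key := cheb (fun ω : Om n => if outN ω u = A then Wt q ω else 0) hw ((insert u A)ᶜ)
    (fun v ω => NoHit A v ω) (Pr q (fun ω : Om n => outN ω u = A)) ((1 - q) ^ A.card) _ ht ?_ ?_ ?_
  · have hm0 : 0 ≤ Pr q (fun ω : Om n => outN ω u = A) := by
      rw [hm]; apply mul_nonneg <;> apply pow_nonneg <;> linarith
    refine le_trans ?_ (key.trans ?_)
    · refine Finset.sum_le_sum fun ω _ => ?_
      by_cases hA : outN ω u = A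
      · by_cases hc : ((insert u A)ᶜ).card <
          A.card + (((insert u A)ᶜ).filter (fun v => NoHit A v ω)).card
        · rw [if_pos ⟨hA, hc⟩, if_pos hA, if_pos]
          refine le_trans ?_ (le_abs_self _)
          have : (((insert u A)ᶜ).card : ℝ) <
            A.card + (((insert u A)ᶜ).filter (fun v => NoHit A v ω)).card := by exact_mod_cast hc
          linarith
        · rw [if_neg (fun h => hc h.2), if_pos hA]
          split_ifs
          · exact Wt_nonneg hq0.le hq2 ω
          · exact le_rfl
      · rw [if_neg (fun h => hA h.1), if_neg hA]; simp
    · rw [mul_div_assoc]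
      exact mul_le_mul_of_nonneg_left har hm0
  · unfold Pr
    refine Finset.sum_congr rfl fun ω _ => ?_
    by_cases hA : outN ω u = A <;> simp [hA]
  · intro v hv
    have := Pr_A q u A {v} hu (by simpa using hv)
    rw [hm]
    rw [Finset.card_singleton, mul_one, pow_add] at this
    rw [mul_right_comm, ← this]
    unfold Pr
    refine Finset.sum_congr rfl fun ω _ => ?_
    by_cases hA : outN ω u = A <;> by_cases hb : NoHit A v ω
    · rw [if_pos hb, if_pos hA, if_pos ⟨hA, by simpa [NoHit] using hb⟩]
    · rw [if_neg hb, if_neg]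
      intro h; exact hb (h.2 v (by simp))
    · rw [if_pos hb, if_neg hA, if_neg]
      intro h; exact hA h.1
    · rw [if_neg hb, if_neg]
      intro h; exact hA h.1
  · intro v hv v' hv' hne
    have := Pr_A q u A {v, v'} hu (by
      intro z hz
      rw [Finset.mem_insert, Finset.mem_singleton] at hz
      rcases hz with rfl | rfl
      · simpa using hv
      · simpa using hv')
    rw [hm]
    rw [Finset.card_pair hne, pow_add, pow_mul] at this
    rw [mul_right_comm, ← this]
    apply le_of_eq
    unfold Pr
    refine Finset.sum_congr rfl fun ω _ => ?_
    by_cases hA : outN ω u = A <;> by_cases hb : NoHit A v ω ∧ NoHit A v' ω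
    · rw [if_pos hb, if_pos hA, if_pos]
      refine ⟨hA, ?_⟩
      intro z hz
      rw [Finset.mem_insert, Finset.mem_singleton] at hz
      rcases hz with rfl | rfl
      · exact hb.1
      · exact hb.2
    · rw [if_neg hb, if_neg]
      intro h; exact hb ⟨h.2 v (by simp), h.2 v' (by simp)⟩
    · rw [if_pos hb, if_neg hA, if_neg]
      intro h; exact hA h.1
    · rw [if_neg hb, if_neg]
      intro h; exact hA h.1

lemma mid_deg {n : ℕ} {q : ℝ} (hq0 : 0 < q) (hq : q ≤ 1 / 10)
    (hL8 : 8 ≤ ((n - 1 : ℕ) : ℝ) * q) (u : Fin n) :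
    Pr q (fun ω : Om n => ((n - 1 : ℕ) : ℝ) * q / 2 ≤
      |((outN ω u).card : ℝ) - ((n - 1 : ℕ) : ℝ) * q|) ≤ 4 / (((n - 1 : ℕ) : ℝ) * q) := by
  have hq2 : q ≤ 1 / 2 := by linarith
  have hT : (((Finset.univ : Finset (Fin n)).erase u).card) = n - 1 := by simp
  have hf : ∀ ω : Om n, (Finset.univ.erase u).filter (fun v => dig ω u v) = outN ω u := by
    intro ω
    ext v
    simp only [Finset.mem_filter, Finset.mem_erase, Finset.mem_univ, and_true, mem_outN,
      and_iff_right_iff_imp]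
    rintro h rfl
    exact dig_irrefl _ _ h
  have key := cheb (Wt q) (Wt_nonneg hq0.le hq2) ((Finset.univ : Finset (Fin n)).erase u)
    (fun v ω => dig ω u v) 1 q (((n - 1 : ℕ) : ℝ) * q / 2) (by linarith) (Pr_univ q) ?_ ?_
  · simp only [hT, hf] at key
    refine le_trans (le_of_eq ?_) (key.trans ?_)
    · rfl
    · rw [div_le_div_iff₀ (by apply pow_pos; linarith) (by linarith)]
      set L := ((n - 1 : ℕ) : ℝ) * q with hL
      have : 1 * (((n - 1 : ℕ) : ℝ) * (q * (1 - q))) = L * (1 - q) := by rw [hL]; ring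
      rw [this]
      have : 0 < L * L * q := by apply mul_pos _ hq0; nlinarith
      nlinarith
  · intro v hv
    rw [Finset.mem_erase] at hv
    have h := Pr_box (n := n) q ∅ {(u, v)} (by simp) (by simp; intro h; exact absurd h hv.1)
    simp only [Finset.card_empty, Finset.card_singleton, pow_zero, pow_one] at h
    rw [← h]
    unfold Pr
    refine Finset.sum_congr rfl fun ω _ => ?_
    by_cases hb : dig ω u v <;> simp [hb]
  · intro v hv v' hv' hne
    rw [Finset.mem_erase] at hv hv'
    have h := Pr_box (n := n) q ∅ {(u, v), (u, v')} (by simp) (by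
      have := hv.1
      have := hv'.1
      simp
      grind)
    rw [Finset.card_pair (by simpa using hne), Finset.card_empty, pow_zero] at h
    rw [← h]
    apply le_of_eq
    unfold Pr
    refine Finset.sum_congr rfl fun ω _ => ?_
    by_cases hb : dig ω u v <;> by_cases hb' : dig ω u v' <;> simp [hb, hb']

lemma mid {n : ℕ} (hn : 0 < n) {q : ℝ} (hq0 : 0 < q) (hq : q ≤ 1 / 10)
    (hL8 : 8 ≤ ((n - 1 : ℕ) : ℝ) * q) :
    Pr q (fun ω : Om n => ¬ HasSeymourVertex (dig ω)) ≤ 16 / (((n - 1 : ℕ) : ℝ) * q) := by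
  have hq2 : q ≤ 1 / 2 := by linarith
  let u : Fin n := ⟨0, hn⟩
  set L := ((n - 1 : ℕ) : ℝ) * q with hL
  let 𝒜 : Finset (Finset (Fin n)) := Finset.univ.filter fun A =>
    u ∉ A ∧ L / 2 ≤ A.card ∧ (A.card : ℝ) ≤ 3 * L / 2
  have h1 : Pr q (fun ω : Om n => ¬ HasSeymourVertex (dig ω)) ≤ Pr q (fun ω : Om n =>
      (L / 2 ≤ |((outN ω u).card : ℝ) - L|) ∨ ∃ A ∈ 𝒜, (outN ω u = A ∧ ((insert u A)ᶜ).card <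
      A.card + (((insert u A)ᶜ).filter (fun v => NoHit A v ω)).card)) := by
    refine Pr_mono hq0.le hq2 fun ω hω => ?_
    by_contra hc
    push Not at hc
    obtain ⟨ha, hb⟩ := hc
    rw [abs_lt] at ha
    apply hω
    refine ⟨u, seymour_of ω u ?_⟩
    have := hb (outN ω u) (by
      simp only [𝒜, Finset.mem_filter, Finset.mem_univ, true_and]
      exact ⟨notMem_outN _ _, by linarith, by linarith⟩) rfl
    refine le_trans (le_of_eq ?_) this
    congr 2
    ext v
    rw [Finset.mem_filter, Finset.mem_filter]
    rfl
  refine h1.trans ((Pr_or_le hq0.le hq2 _ _).trans ?_)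
  have h2 := mid_deg hq0 hq hL8 u
  have h3 : ∑ A ∈ 𝒜, Pr q (fun ω : Om n => outN ω u = A) ≤ 1 := by
    rw [← Pr_univ (n := n) q]
    unfold Pr
    rw [Finset.sum_comm]
    refine Finset.sum_le_sum fun ω _ => ?_
    have hW := Wt_nonneg hq0.le hq2 ω
    calc _ = ∑ A ∈ 𝒜, if outN ω u = A then Wt q ω else 0 :=
          Finset.sum_congr rfl fun A _ => by by_cases h : outN ω u = A <;> simp [h]
      _ ≤ _ := by
        rw [Finset.sum_ite_eq]
        by_cases h : outN ω u ∈ 𝒜 <;> simp [h, hW]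
  have h4 : Pr q (fun ω : Om n => ∃ A ∈ 𝒜, (outN ω u = A ∧ ((insert u A)ᶜ).card <
      A.card + (((insert u A)ᶜ).filter (fun v => NoHit A v ω)).card)) ≤ 12 / L := by
    refine (Pr_exists_le hq0.le hq2 _ _).trans ?_
    refine (Finset.sum_le_sum (g := fun A => Pr q (fun ω : Om n => outN ω u = A) * (12 / L))
      fun A hA => ?_).trans ?_
    · simp only [𝒜, Finset.mem_filter, Finset.mem_univ, true_and] at hA
      exact mid_step hq0 hq hL8 u A hA.1 hA.2.1 hA.2.2
    · rw [← Finset.sum_mul]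
      have : 0 ≤ 12 / L := by apply div_nonneg <;> linarith
      nlinarith
  have : 16 / L = 4 / L + 12 / L := by ring
  rw [this]
  exact add_le_add h2 h4

lemma Pr_compl {n : ℕ} (q : ℝ) (E : Om n → Prop) : Pr q E = 1 - Pr q (fun ω => ¬ E ω) := by
  rw [eq_sub_iff_add_eq, ← Pr_univ (n := n) q]
  unfold Pr
  rw [← Finset.sum_add_distrib]
  refine Finset.sum_congr rfl fun ω _ => ?_
  by_cases h : E ω <;> simp [h]

lemma bad_bound {n : ℕ} (hn : 2 ≤ n) (hlog : 32 ≤ Real.log n) {q : ℝ} (hq0 : 0 < q)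
    (hq : q ≤ 1 / 2) : Pr q (fun ω : Om n => ¬ HasSeymourVertex (dig ω)) ≤
      64 / Real.log n + Real.exp (-(Real.log n / 2)) + n ^ 2 * (99 / 100 : ℝ) ^ (n - 2) := by
  have p1 : 0 ≤ 64 / Real.log n := by apply div_nonneg <;> linarith
  have p2 := Real.exp_pos (-(Real.log n / 2))
  have p3 : 0 ≤ n ^ 2 * (99 / 100 : ℝ) ^ (n - 2) := by positivity
  rcases le_total (1 / 10) q with h | h
  · have := dense hn h hq
    linarith
  · rcases le_total (Real.log n / 4) (((n - 1 : ℕ) : ℝ) * q) with h' | h'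
    · have := mid (n := n) (by omega) hq0 h (by linarith)
      have h2 : 16 / (((n - 1 : ℕ) : ℝ) * q) ≤ 64 / Real.log n := by
        rw [div_le_div_iff₀ (by linarith) (by linarith)]
        linarith
      linarith
    · have := sparse (n := n) (by omega) hq0.le hq
      have hn' : (0 : ℝ) < n := by exact_mod_cast (by omega : 0 < n)
      have h1 : Real.exp (-(2 * q)) ≤ 1 - q := by
        rw [Real.exp_neg]
        apply inv_le_of_inv_le₀ (by linarith)
        rw [inv_le_iff_one_le_mul₀ (by linarith)]
        have := Real.add_one_le_exp (2 * q)
        nlinarith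
      have h2 : Real.exp (-(Real.log n / 2)) ≤ (1 - q) ^ (n - 1) := by
        calc Real.exp (-(Real.log n / 2)) ≤ Real.exp (((n - 1 : ℕ) : ℝ) * (-(2 * q))) := by
              apply Real.exp_le_exp.2; linarith
          _ = Real.exp (-(2 * q)) ^ (n - 1) := by rw [Real.exp_nat_mul]
          _ ≤ _ := by gcongr
      have h3 : 1 / (n * (1 - q) ^ (n - 1)) ≤ Real.exp (-(Real.log n / 2)) := by
        rw [div_le_iff₀ (by apply mul_pos hn'; apply pow_pos; linarith)]
        calc (1 : ℝ) = Real.exp (-(Real.log n / 2)) *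
              (Real.exp (Real.log n) * Real.exp (-(Real.log n / 2))) := by
              rw [← Real.exp_add, ← Real.exp_add]
              rw [← Real.exp_zero]; congr 1; ring
          _ ≤ _ := by rw [Real.exp_log hn']; gcongr
      linarith

end

theorem snc_gnp_random_orientation (p : ℕ → ℝ) (hp : ∀ n, p n ∈ Set.Ioo (0 : ℝ) 1) :
    Filter.Tendsto
      (fun n => gnpOrientProb n (p n) {D | HasSeymourVertex D})
      Filter.atTop (nhds 1) := by
  have hlog : Filter.Tendsto (fun n : ℕ => Real.log n) Filter.atTop Filter.atTop :=
    Real.tendsto_log_atTop.comp tendsto_natCast_atTop_atTop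
  have t1 : Filter.Tendsto (fun n : ℕ => 64 / Real.log n) Filter.atTop (nhds 0) :=
    hlog.const_div_atTop 64
  have t2 : Filter.Tendsto (fun n : ℕ => Real.exp (-(Real.log n / 2))) Filter.atTop (nhds 0) :=
    Real.tendsto_exp_neg_atTop_nhds_zero.comp (hlog.atTop_div_const (by norm_num))
  have t3 : Filter.Tendsto (fun n : ℕ => (n : ℝ) ^ 2 * (99 / 100 : ℝ) ^ (n - 2))
      Filter.atTop (nhds 0) := by
    have h := (tendsto_pow_const_mul_const_pow_of_abs_lt_one 2
      (r := (99 / 100 : ℝ)) (by rw [abs_lt]; norm_num)).mul_const (((99 / 100 : ℝ) ^ 2)⁻¹)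
    rw [zero_mul] at h
    refine h.congr' ?_
    filter_upwards [Filter.eventually_ge_atTop 2] with n hn
    obtain ⟨k, rfl⟩ := Nat.exists_eq_add_of_le' hn
    rw [Nat.add_sub_cancel, pow_add]
    field_simp
  have t := (t1.add t2).add t3
  simp only [add_zero] at t
  have t' := t.const_sub 1
  rw [sub_zero] at t'
  refine tendsto_of_tendsto_of_tendsto_of_le_of_le' t' tendsto_const_nhds ?_ ?_
  · filter_upwards [Filter.eventually_ge_atTop 2, hlog.eventually_ge_atTop 32] with n hn hl
    obtain ⟨h0, h1⟩ := hp n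
    rw [bridge, Pr_compl]
    have := bad_bound hn hl (q := p n / 2) (by linarith) (by linarith)
    exact sub_le_sub_left this 1
  · refine Filter.Eventually.of_forall fun n => ?_
    obtain ⟨h0, h1⟩ := hp n
    rw [bridge, Pr_compl]
    have : 0 ≤ Pr (p n / 2) (fun ω : Om n => ¬ dig ω ∈ {D | HasSeymourVertex D}) := by
      refine Finset.sum_nonneg fun ω _ => ?_
      have := Wt_nonneg (q := p n / 2) (by linarith) (by linarith) ω
      split_ifs <;> first | exact this | exact le_rfl
    linarith
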